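/- arXiv:2602.10232 — 4 statements merged into one kernel-verified Lean document; each statement's English description precedes it below -/
import Mathlib

section
/- Let Z be a type with a distinguished null record ⊥, let n be a positive natural number, and call two datasets D, D' : Fin n → Z neighbors if one is obtained from the other by replacing a single coordinate with ⊥ (i.e., there exists i with D' = Function.update D i ⊥ or D = Function.update D' i ⊥). Let W : Kernel (Fin n → Z) Ω₁ and A : Kernel (Ω₁ × (Fin n → Z)) Ω₂ be Markov kernels on measurable spaces Ω₁, Ω₂. Suppose W is (ε_s, δ_s)-differentially private (for all neighboring D, D' and all measurable S ⊆ Ω₁, (W D) S ≤ exp(ε_s) · (W D') S + δ_s), and for every fixed w ∈ Ω₁ the kernel D ↦ A (w, D) is (ε_t, δ_t)-differentially private. Then the composed mechanism M : (Fin n → Z) → Measure (Ω₁ × Ω₂) given by M D = (W D).bind (fun w => ((A (w, D)).map (fun θ => (w, θ)))) is (ε_s + ε_t, δ_s + δ_t)-differentially private: for all neighboring D, D' and all measurable S ⊆ Ω₁ × Ω₂, (M D) S ≤ exp(ε_s + ε_t) · (M D') S + (δ_s + δ_t). -/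
open MeasureTheory ProbabilityTheory

lemma dp_lintegral {Ω : Type*} [MeasurableSpace Ω] (μ ν : Measure Ω)
    (c d : ENNReal) (hc : c ≠ ⊤)
    (h : ∀ S, MeasurableSet S → μ S ≤ c * ν S + d)
    (f : Ω → ENNReal) (hf : Measurable f) (hf1 : ∀ x, f x ≤ 1) :
    ∫⁻ x, f x ∂μ ≤ c * ∫⁻ x, f x ∂ν + d := by
  have key : ∀ ρ : Measure Ω, ∫⁻ x, f x ∂ρ =
      ∫⁻ t in Set.Ioi (0:ℝ), ρ {a | t < (f a).toReal} := by
    intro ρ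
    rw [← lintegral_eq_lintegral_meas_lt ρ (Filter.Eventually.of_forall fun x => ENNReal.toReal_nonneg)
      hf.ennreal_toReal.aemeasurable]
    refine lintegral_congr fun x => ?_
    rw [ENNReal.ofReal_toReal (ne_top_of_le_ne_top ENNReal.one_ne_top (hf1 x))]
  rw [key μ, key ν]
  calc _ ≤ ∫⁻ t in Set.Ioi (0:ℝ), (c * ν {a | t < (f a).toReal}
            + (Set.Iio (1:ℝ)).indicator (fun _ => d) t) := by
        refine lintegral_mono fun t => ?_
        by_cases ht : t < 1
        · simpa [Set.indicator, ht] using h _ (measurableSet_lt measurable_const hf.ennreal_toReal)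
        · have : {a | t < (f a).toReal} = ∅ := by
            ext a
            have := ENNReal.toReal_mono ENNReal.one_ne_top (hf1 a)
            simp at this ⊢
            linarith
          simp [this]
    _ = _ := by
        rw [lintegral_add_right _ (measurable_const.indicator measurableSet_Iio),
          lintegral_const_mul' _ _ hc, lintegral_indicator measurableSet_Iio]
        simp [Measure.restrict_apply, Set.Iio_inter_Ioi]

lemma dp_bind_apply {Z Ω₁ Ω₂ : Type*} [MeasurableSpace Z] [MeasurableSpace Ω₁] [MeasurableSpace Ω₂]
    (μ : Measure Ω₁) (A : Kernel (Ω₁ × Z) Ω₂) [IsMarkovKernel A] (D : Z)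
    (S : Set (Ω₁ × Ω₂)) (hS : MeasurableSet S) :
    Measurable (fun w => A (w, D) (Prod.mk w ⁻¹' S)) ∧
    (μ.bind (fun w => ((A (w, D)).map (fun θ => (w, θ))))) S
      = ∫⁻ w, A (w, D) (Prod.mk w ⁻¹' S) ∂μ := by
  have hm : ∀ S : Set (Ω₁ × Ω₂), MeasurableSet S →
      Measurable (fun w => A (w, D) (Prod.mk w ⁻¹' S)) := by
    intro S hS
    have := Kernel.measurable_kernel_prodMk_left (κ := A.comap (fun w => (w, D)) (by fun_prop)) hS
    simpa [Kernel.comap_apply] using this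
  have hap : ∀ S : Set (Ω₁ × Ω₂), MeasurableSet S → ∀ w,
      (A (w, D)).map (fun θ => (w, θ)) S = A (w, D) (Prod.mk w ⁻¹' S) := fun S hS w =>
    Measure.map_apply measurable_prodMk_left hS
  refine ⟨hm S hS, ?_⟩
  rw [Measure.bind_apply hS]
  · exact lintegral_congr (hap S hS)
  · refine (Measure.measurable_of_measurable_coe _ fun S hS => ?_).aemeasurable
    simp_rw [hap S hS]
    exact hm S hS

/-- Composition of a DP scoring kernel `W` and a DP learning kernel `A`
(for every fixed score output) yields an `(ε_s + ε_t, δ_s + δ_t)`-DP composed mechanism,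
with respect to the replace-one-coordinate-by-the-null-record neighbor relation. -/
theorem reps_composition
    {Z Ω₁ Ω₂ : Type*} [MeasurableSpace Z] [MeasurableSpace Ω₁] [MeasurableSpace Ω₂]
    (nullz : Z) (n : ℕ) (hn : 0 < n)
    (W : Kernel (Fin n → Z) Ω₁) (A : Kernel (Ω₁ × (Fin n → Z)) Ω₂)
    [IsMarkovKernel W] [IsMarkovKernel A]
    (εs εt δs δt : ℝ) (hεs : 0 ≤ εs) (hεt : 0 ≤ εt) (hδs : 0 ≤ δs) (hδt : 0 ≤ δt)
    (hW : ∀ D D' : Fin n → Z,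
      (∃ i, D' = Function.update D i nullz ∨ D = Function.update D' i nullz) →
      ∀ S : Set Ω₁, MeasurableSet S →
        W D S ≤ ENNReal.ofReal (Real.exp εs) * W D' S + ENNReal.ofReal δs)
    (hA : ∀ w : Ω₁, ∀ D D' : Fin n → Z,
      (∃ i, D' = Function.update D i nullz ∨ D = Function.update D' i nullz) →
      ∀ T : Set Ω₂, MeasurableSet T →
        A (w, D) T ≤ ENNReal.ofReal (Real.exp εt) * A (w, D') T + ENNReal.ofReal δt) :
    ∀ D D' : Fin n → Z,
      (∃ i, D' = Function.update D i nullz ∨ D = Function.update D' i nullz) →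
      ∀ S : Set (Ω₁ × Ω₂), MeasurableSet S →
        ((W D).bind (fun w => ((A (w, D)).map (fun θ => (w, θ))))) S ≤
          ENNReal.ofReal (Real.exp (εs + εt)) *
            ((W D').bind (fun w => ((A (w, D')).map (fun θ => (w, θ))))) S
          + ENNReal.ofReal (δs + δt) := by
  intro D D' hD S hS
  obtain ⟨-, e1⟩ := dp_bind_apply (W D) A D S hS
  obtain ⟨m2, e2⟩ := dp_bind_apply (W D') A D' S hS
  rw [e1, e2]
  have hmin : Measurable (fun w => min 1 (ENNReal.ofReal (Real.exp εt) * A (w, D') (Prod.mk w ⁻¹' S))) :=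
    measurable_const.min (m2.const_mul _)
  calc ∫⁻ w, A (w, D) (Prod.mk w ⁻¹' S) ∂(W D)
      ≤ ∫⁻ w, (min 1 (ENNReal.ofReal (Real.exp εt) * A (w, D') (Prod.mk w ⁻¹' S))
          + ENNReal.ofReal δt) ∂(W D) := by
        refine lintegral_mono fun w => ?_
        rw [← min_add_add_right]
        exact le_min (prob_le_one.trans le_self_add)
          (hA w D D' hD _ (measurable_prodMk_left hS))
    _ = ∫⁻ w, min 1 (ENNReal.ofReal (Real.exp εt) * A (w, D') (Prod.mk w ⁻¹' S)) ∂(W D)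
          + ENNReal.ofReal δt := by
        rw [lintegral_add_right _ measurable_const]
        simp
    _ ≤ (ENNReal.ofReal (Real.exp εs) *
          ∫⁻ w, min 1 (ENNReal.ofReal (Real.exp εt) * A (w, D') (Prod.mk w ⁻¹' S)) ∂(W D')
          + ENNReal.ofReal δs) + ENNReal.ofReal δt := by
        gcongr
        exact dp_lintegral _ _ _ _ ENNReal.ofReal_ne_top (hW D D' hD) _ hmin fun _ => min_le_left _ _
    _ ≤ (ENNReal.ofReal (Real.exp εs) *
          ∫⁻ w, ENNReal.ofReal (Real.exp εt) * A (w, D') (Prod.mk w ⁻¹' S) ∂(W D')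
          + ENNReal.ofReal δs) + ENNReal.ofReal δt := by
        gcongr
        exact min_le_right _ _
    _ = _ := by
        rw [lintegral_const_mul _ m2, Real.exp_add, ENNReal.ofReal_mul (Real.exp_pos _).le,
          ENNReal.ofReal_add hδs hδt, mul_assoc, add_assoc]
end

section
/- Let k be a positive natural number, σ > 0, δ ∈ (0, 1), and let x, x' ∈ EuclideanSpace ℝ (Fin k). Set α = ‖x − x'‖₂ and ε = (α / σ) · √(2 · log(1.25 / δ)), and assume ε < 1 and α > 0. Let μ be the product measure on Fin k → ℝ whose j-th coordinate is the Gaussian measure with mean x_j and variance σ², and let μ' be the analogous product Gaussian measure with means x'_j. Then for every measurable set S ⊆ (Fin k → ℝ), μ S ≤ exp(ε) · μ' S + δ. -/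
open MeasureTheory ProbabilityTheory

lemma aux_half : gaussianReal 0 1 (Set.Ioi 0) ≤ ENNReal.ofReal (1/2) := by
  have h1 : gaussianReal 0 1 (Set.Iio 0) = gaussianReal 0 1 (Set.Ioi 0) := by
    conv_lhs => rw [← neg_zero, ← gaussianReal_map_neg,
      Measure.map_apply (by fun_prop) measurableSet_Iio]
    congr 1
    ext y
    simp
  have h2 : gaussianReal 0 1 (Set.Iio 0) + gaussianReal 0 1 (Set.Ioi 0) ≤ 1 := by
    rw [← measure_union (by
      rw [Set.disjoint_left]; intro y hy hy'; exact lt_asymm (Set.mem_Iio.1 hy) (Set.mem_Ioi.1 hy')) measurableSet_Ioi]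
    exact prob_le_one
  rw [h1] at h2
  have hne : gaussianReal 0 1 (Set.Ioi 0) ≠ ⊤ := measure_ne_top _ _
  rw [ENNReal.le_ofReal_iff_toReal_le hne (by norm_num)]
  have := ENNReal.toReal_mono (by simp) h2
  rw [ENNReal.toReal_add hne hne] at this
  simp at this
  linarith

lemma aux_tail_pos (t : ℝ) (ht : 0 ≤ t) :
    gaussianReal 0 1 (Set.Ioi t) ≤ ENNReal.ofReal (Real.exp (-t^2/2) * (1/2)) := by
  have h1 : gaussianReal 0 1 (Set.Ioi t) = gaussianReal (-t) 1 (Set.Ioi 0) := by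
    have := gaussianReal_map_add_const (μ := 0) (v := 1) (-t)
    rw [zero_add] at this
    rw [← this, Measure.map_apply (by fun_prop) measurableSet_Ioi]
    congr 1
    ext y
    simp
  rw [h1, gaussianReal_apply _ (by simp), ENNReal.ofReal_mul (by positivity)]
  refine le_trans ?_ (mul_le_mul_right aux_half _)
  rw [gaussianReal_apply _ (by simp), ← lintegral_const_mul _ (measurable_gaussianPDF _ _)]
  refine setLIntegral_mono (by have := measurable_gaussianPDF 0 1; fun_prop) ?_
  intro s hs
  have hs : 0 < s := hs
  simp only [gaussianPDF]
  rw [← ENNReal.ofReal_mul (by positivity)]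
  apply ENNReal.ofReal_le_ofReal
  simp only [gaussianPDFReal]
  rw [mul_left_comm, ← Real.exp_add]
  gcongr
  simp
  nlinarith [mul_nonneg ht hs.le]

lemma aux_tail_neg (t : ℝ) (ht : t ≤ 0) :
    gaussianReal 0 1 (Set.Ioi t) ≤ ENNReal.ofReal (1/2 - t) := by
  have h : Set.Ioi t ⊆ Set.Ioi 0 ∪ Set.Icc t 0 := by
    intro y hy
    have hy : t < y := hy
    rcases lt_or_ge 0 y with h | h
    · exact Or.inl h
    · exact Or.inr ⟨hy.le, h⟩
  refine (measure_mono h).trans ((measure_union_le _ _).trans ?_)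
  rw [sub_eq_add_neg, ENNReal.ofReal_add (by norm_num) (by linarith)]
  refine add_le_add aux_half ?_
  rw [gaussianReal_apply _ (by simp)]
  calc _ ≤ ∫⁻ _ in Set.Icc t 0, 1 := by
        refine setLIntegral_mono (by fun_prop) ?_
        intro s hs
        simp only [gaussianPDF]
        rw [ENNReal.ofReal_le_one]
        simp only [gaussianPDFReal]
        refine mul_le_one₀ ?_ (by positivity) ?_
        · apply inv_le_one_of_one_le₀
          rw [Real.one_le_sqrt]
          simp
          nlinarith [Real.pi_gt_three]
        · rw [Real.exp_le_one_iff]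
          simp only [sub_zero, NNReal.coe_one, mul_one]
          nlinarith [sq_nonneg s]
    _ = _ := by simp

lemma aux_tail (a c δ : ℝ) (ha : 0 < a) (hδ0 : 0 < δ) (hδ1 : δ < 1)
    (hc : c = Real.sqrt (2 * Real.log (1.25 / δ))) (hac : a * c < 1) :
    gaussianReal 0 1 (Set.Ioi (c - a / 2)) ≤ ENNReal.ofReal δ := by
  have hlog : 0.2 ≤ Real.log (1.25 / δ) := by
    have h1 := Real.one_sub_inv_le_log_of_pos (show 0 < 1.25 / δ by positivity)
    have h2 : (1.25 / δ)⁻¹ = δ * 0.8 := by field_simp; norm_num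
    rw [h2] at h1
    linarith
  have hc2 : c ^ 2 = 2 * Real.log (1.25 / δ) := by
    rw [hc, Real.sq_sqrt (by linarith)]
  have hc0 : 0 ≤ c := hc ▸ Real.sqrt_nonneg _
  have hδ : δ = 1.25 * Real.exp (- c ^ 2 / 2) := by
    have : - c ^ 2 / 2 = - Real.log (1.25 / δ) := by rw [neg_div, hc2]; ring
    rw [this, Real.exp_neg, Real.exp_log (by positivity)]
    field_simp
  rcases le_total 0 (c - a / 2) with h | h
  · refine (aux_tail_pos _ h).trans (ENNReal.ofReal_le_ofReal ?_)
    rw [hδ]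
    have h1 : Real.exp (-(c - a / 2) ^ 2 / 2) ≤ Real.exp (- c ^ 2 / 2) * Real.exp (1/2) := by
      rw [← Real.exp_add]
      apply Real.exp_le_exp.2
      nlinarith [sq_nonneg a]
    have h2 : Real.exp (1/2) ≤ 2.5 := by
      have : Real.exp (1/2) ≤ Real.exp 1 := Real.exp_le_exp.2 (by norm_num)
      have h3 : Real.exp (1/2) ^ 2 = Real.exp 1 := by
        rw [← Real.exp_nat_mul]; norm_num
      nlinarith [Real.exp_one_lt_d9, Real.exp_pos (1/2)]
    nlinarith [Real.exp_pos (- c ^ 2 / 2)]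
  · refine (aux_tail_neg _ h).trans (ENNReal.ofReal_le_ofReal ?_)
    have h1 : c ^ 2 ≤ 1 / 2 := by nlinarith
    have h2 : 0.9375 ≤ δ := by
      rw [hδ]
      have := Real.add_one_le_exp (- c ^ 2 / 2)
      linarith
    have h3 : 0.6 ≤ c := by nlinarith
    nlinarith

lemma aux_dens1 (m m' : ℝ) (v : NNReal) (hv : v ≠ 0) :
    gaussianReal m v = (gaussianReal m' v).withDensity
      (fun t => ENNReal.ofReal (Real.exp (((m - m') * (t - m) + (m - m')^2 / 2) / v))) := by
  have hv' : (0:ℝ) < v := by positivity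
  rw [gaussianReal_of_var_ne_zero _ hv, gaussianReal_of_var_ne_zero _ hv,
    ← withDensity_mul _ (measurable_gaussianPDF _ _) (by fun_prop)]
  congr 1
  ext t
  simp only [gaussianPDF, Pi.mul_apply]
  rw [← ENNReal.ofReal_mul (gaussianPDFReal_nonneg _ _ _)]
  congr 1
  simp only [gaussianPDFReal]
  rw [mul_assoc _ (Real.exp _) (Real.exp _), ← Real.exp_add]
  congr 2
  field_simp
  ring

lemma aux_pi {k : ℕ} (μ : Fin k → Measure ℝ) [∀ i, IsProbabilityMeasure (μ i)]
    (f : Fin k → ℝ → ENNReal) (hf : ∀ i, Measurable (f i))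
    (hp : ∀ i, SigmaFinite ((μ i).withDensity (f i))) :
    Measure.pi (fun i => (μ i).withDensity (f i)) =
      (Measure.pi μ).withDensity (fun y => ∏ i, f i (y i)) := by
  refine Measure.pi_eq ?_
  intro s hs
  rw [withDensity_apply _ (MeasurableSet.univ_pi hs),
    ← lintegral_indicator (MeasurableSet.univ_pi hs)]
  have h1 : (Set.pi Set.univ s).indicator (fun y : Fin k → ℝ => ∏ i, f i (y i)) =
      fun y => ∏ i, (s i).indicator (f i) (y i) := by
    ext y
    by_cases hy : y ∈ Set.pi Set.univ s
    · rw [Set.indicator_of_mem hy]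
      refine Finset.prod_congr rfl fun i _ => ?_
      rw [Set.indicator_of_mem (hy i trivial)]
    · rw [Set.indicator_of_notMem hy]
      simp only [Set.mem_pi, not_forall] at hy
      obtain ⟨i, _, hi⟩ := hy
      symm
      exact Finset.prod_eq_zero (Finset.mem_univ i) (Set.indicator_of_notMem hi _)
  have hm : ∀ i, Measurable ((s i).indicator (f i)) := fun i => (hf i).indicator (hs i)
  rw [h1, lintegral_prod_eq_prod_lintegral_of_indepFun Finset.univ
    (fun i (y : Fin k → ℝ) => (s i).indicator (f i) (y i))
    (iIndepFun_pi (fun i => (hm i).aemeasurable))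
    (fun i => (hm i).comp (measurable_pi_apply i))]
  refine Finset.prod_congr rfl fun i _ => ?_
  rw [withDensity_apply _ (hs i), ← lintegral_indicator (hs i),
    ← (measurePreserving_eval μ i).lintegral_comp (hm i)]

lemma aux_law {k : ℕ} (x : Fin k → ℝ) (w : Fin k → ℝ) (v : NNReal)
    (hw : ∑ i, (w i)^2 * v = 1) :
    (Measure.pi (fun j => gaussianReal (x j) v)).map (fun y => ∑ i, w i * (y i - x i)) =
      gaussianReal 0 1 := by
  have hm : ∀ i, Measurable (fun t : ℝ => w i * (t - x i)) := fun i => by fun_prop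
  have : IsProbabilityMeasure ((Measure.pi (fun j => gaussianReal (x j) v)).map
      (fun y => ∑ i, w i * (y i - x i))) :=
    Measure.isProbabilityMeasure_map
      (Measurable.aemeasurable (by fun_prop))
  refine Measure.ext_of_charFun ?_
  rw [iIndepFun.charFun_map_fun_sum_eq_prod
    (X := fun i (y : Fin k → ℝ) => w i * (y i - x i))
    (fun i => Measurable.aemeasurable (by fun_prop))
    (iIndepFun_pi (μ := fun j => gaussianReal (x j) v) (X := fun i t => w i * (t - x i))
      (fun i => (hm i).aemeasurable))]
  have h : ∀ i, (Measure.pi (fun j => gaussianReal (x j) v)).map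
      (fun y => w i * (y i - x i)) = gaussianReal 0 (NNReal.mk ((w i)^2) (sq_nonneg _) * v) := by
    intro i
    have e1 := (measurePreserving_eval (fun j => gaussianReal (x j) v) i).map_eq
    have : (fun y : Fin k → ℝ => w i * (y i - x i)) =
      (fun t => w i * t) ∘ (fun t => t - x i) ∘ (Function.eval i) := rfl
    rw [this, ← Measure.map_map (by fun_prop) (by fun_prop),
      ← Measure.map_map (by fun_prop) (by fun_prop), e1, gaussianReal_map_sub_const,
      gaussianReal_map_const_mul]
    simp
  ext t
  rw [Finset.prod_apply]
  simp only [h, charFun_gaussianReal]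
  rw [← Complex.exp_sum]
  congr 1
  have hw' : ∑ i, ((w i : ℂ))^2 * (v:ℝ) = 1 := by exact_mod_cast hw
  have e : ∀ i, (((NNReal.mk ((w i)^2) (sq_nonneg _) * v : NNReal) : ℝ) : ℂ)
      = (w i : ℂ)^2 * (v:ℝ) := fun i => by push_cast; simp
  simp only [e, Complex.ofReal_zero, mul_zero, zero_mul, zero_sub, NNReal.coe_one,
    Complex.ofReal_one]
  rw [Finset.sum_neg_distrib, ← Finset.sum_div, ← Finset.sum_mul, hw']

theorem gaussian_mechanism_pair
    (k : ℕ) (hk : 0 < k) (σ : ℝ) (hσ : 0 < σ) (δ : ℝ) (hδ0 : 0 < δ) (hδ1 : δ < 1)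
    (x x' : EuclideanSpace ℝ (Fin k))
    (hα : 0 < ‖x - x'‖)
    (hε : (‖x - x'‖ / σ) * Real.sqrt (2 * Real.log (1.25 / δ)) < 1) :
    ∀ S : Set (Fin k → ℝ), MeasurableSet S →
      Measure.pi (fun j => gaussianReal (x j) ⟨σ ^ 2, sq_nonneg σ⟩) S ≤
        ENNReal.ofReal
            (Real.exp ((‖x - x'‖ / σ) * Real.sqrt (2 * Real.log (1.25 / δ)))) *
          Measure.pi (fun j => gaussianReal (x' j) ⟨σ ^ 2, sq_nonneg σ⟩) S
        + ENNReal.ofReal δ := by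
  intro S hS
  set c := Real.sqrt (2 * Real.log (1.25 / δ)) with hc
  set α := ‖x - x'‖ with hαd
  set v : NNReal := ⟨σ ^ 2, sq_nonneg σ⟩ with hvd
  have hvr : (v : ℝ) = σ ^ 2 := rfl
  have hv : v ≠ 0 := by
    intro h
    have : (v : ℝ) = 0 := by rw [h]; rfl
    rw [hvr] at this
    exact (pow_pos hσ 2).ne' this
  have hα2 : ∑ i, (x i - x' i) ^ 2 = α ^ 2 := by
    rw [hαd, EuclideanSpace.real_norm_sq_eq]
    simp
  set w : Fin k → ℝ := fun i => (x i - x' i) / (α * σ) with hw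
  set X : (Fin k → ℝ) → ℝ := fun y => ∑ i, w i * (y i - x i) with hX
  have hXm : Measurable X := by fun_prop
  have hlaw := aux_law x w v (by
    simp only [hw, hvr, div_pow]
    rw [← Finset.sum_mul, ← Finset.sum_div, hα2]
    field_simp)
  set B : Set (Fin k → ℝ) := X ⁻¹' (Set.Ioi (c - α / σ / 2)) with hB
  have hBm : MeasurableSet B := hXm measurableSet_Ioi
  have hBδ : Measure.pi (fun j => gaussianReal (x j) v) B ≤ ENNReal.ofReal δ := by
    rw [hB, ← Measure.map_apply hXm measurableSet_Ioi, hlaw]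
    exact aux_tail _ c δ (by positivity) hδ0 hδ1 hc hε
  set f : Fin k → ℝ → ENNReal := fun i t => ENNReal.ofReal
    (Real.exp (((x i - x' i) * (t - x i) + (x i - x' i)^2 / 2) / v)) with hf
  have hd : Measure.pi (fun j => gaussianReal (x j) v) =
      (Measure.pi (fun j => gaussianReal (x' j) v)).withDensity
        (fun y => ∏ i, f i (y i)) := by
    have e : ∀ i, gaussianReal (x i) v = (gaussianReal (x' i) v).withDensity (f i) :=
      fun i => aux_dens1 (x i) (x' i) v hv
    rw [← aux_pi (fun j => gaussianReal (x' j) v) f (fun i => by fun_prop)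
      (fun i => by rw [← e i]; infer_instance)]
    congr 1
    ext1 i
    exact e i
  have hprod : ∀ y, ∏ i, f i (y i) =
      ENNReal.ofReal (Real.exp (α / σ * X y + (α / σ) ^ 2 / 2)) := by
    intro y
    simp only [hf]
    rw [← ENNReal.ofReal_prod_of_nonneg (fun i _ => by positivity), ← Real.exp_sum]
    congr 2
    rw [← Finset.sum_div, Finset.sum_add_distrib, ← Finset.sum_div, hα2, hX, hvr]
    have : ∑ i, w i * (y i - x i) = (∑ i, (x i - x' i) * (y i - x i)) / (α * σ) := by
      rw [Finset.sum_div]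
      refine Finset.sum_congr rfl fun i _ => ?_
      simp only [hw]
      ring
    simp only [this]
    field_simp
  have hsub : S ⊆ (S \ B) ∪ B := by
    intro y hy
    by_cases h : y ∈ B
    · exact Or.inr h
    · exact Or.inl ⟨hy, h⟩
  refine (measure_mono hsub).trans ((measure_union_le _ _).trans (add_le_add ?_ hBδ))
  rw [hd, withDensity_apply _ (hS.diff hBm)]
  calc _ ≤ ∫⁻ _ in S \ B, ENNReal.ofReal (Real.exp (α / σ * c))
        ∂(Measure.pi (fun j => gaussianReal (x' j) v)) := by
        refine setLIntegral_mono (by fun_prop) ?_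
        intro y hy
        rw [hprod]
        apply ENNReal.ofReal_le_ofReal
        apply Real.exp_le_exp.2
        have h1 : X y ≤ c - α / σ / 2 := not_lt.1 hy.2
        have h2 := mul_le_mul_of_nonneg_left h1 (show 0 ≤ α / σ by positivity)
        nlinarith
    _ ≤ _ := by
        rw [setLIntegral_const]
        gcongr
        exact Set.sdiff_subset
end

section
/- Let Z be a type with a distinguished null record ⊥, n a positive natural number, C > 0, σ > 0, δ_t ∈ (0, 1), φ : Z → EuclideanSpace ℝ (Fin k) with φ(⊥) = 0, and let H ⊆ Fin n be a designated high-risk set. Let 0 < τ_out ≤ C and define weights w i = τ_out / C for i ∈ H and w i = 1 otherwise. Let the mechanism M map D to the product Gaussian measure on Fin k → ℝ with mean vector f_w(D) = (1/n) · Σ_i w i • clip(φ(D i), C) and per-coordinate variance σ². Set ε_out = (τ_out / (n · σ)) · √(2 · log(1.25 / δ_t)) and assume ε_out < 1. Then for every dataset D, every index i ∈ H, and every measurable set S ⊆ (Fin k → ℝ), (M D) S ≤ exp(ε_out) · (M D^(−i)) S + δ_t, where D^(−i) = Function.update D i ⊥. -/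
open MeasureTheory ProbabilityTheory

/-- ℓ₂ clipping of `u` to norm at most `C`: `clip u C = min(1, C/‖u‖) • u`
(so `clip 0 C = 0`, matching the convention `clip(0,C)=0` since `C/0 = 0` in Lean). -/
noncomputable def clip {k : ℕ} (u : EuclideanSpace ℝ (Fin k)) (C : ℝ) :
    EuclideanSpace ℝ (Fin k) :=
  (min 1 (C / ‖u‖)) • u

/-- Weighted clipped aggregate `f_w(D) = (1/n) Σ_i w_i • clip(φ(D_i), C)`. -/
noncomputable def fw {Z : Type*} {k n : ℕ} (φ : Z → EuclideanSpace ℝ (Fin k)) (C : ℝ)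
    (w : Fin n → ℝ) (D : Fin n → Z) : EuclideanSpace ℝ (Fin k) :=
  (1 / (n : ℝ)) • ∑ i, w i • clip (φ (D i)) C

lemma pi_gauss_density {k : ℕ} (x : Fin k → ℝ) (v : NNReal) (hv : v ≠ 0) :
    Measure.pi (fun j => gaussianReal (x j) v) =
      (volume : Measure (Fin k → ℝ)).withDensity
        (fun z => ENNReal.ofReal (∏ j, gaussianPDFReal (x j) v (z j))) := by
  refine Measure.pi_eq fun s hs => ?_
  rw [withDensity_apply _ (MeasurableSet.univ_pi hs), volume_pi, Measure.restrict_pi_pi]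
  rw [← ofReal_integral_eq_lintegral_ofReal]
  · rw [integral_fintype_prod_eq_prod, ENNReal.ofReal_prod_of_nonneg]
    · refine Finset.prod_congr rfl fun i _ => ?_
      rw [gaussianReal_apply_eq_integral _ hv]
    · intro i _
      exact integral_nonneg (gaussianPDFReal_nonneg _ _)
  · exact Integrable.fintype_prod fun i => (integrable_gaussianPDFReal (x i) v).integrableOn
  · exact ae_of_all _ fun z => Finset.prod_nonneg fun i _ => gaussianPDFReal_nonneg _ _ _

lemma key_ineq (l : ℝ) (hl : 0 ≤ l) (v : ℝ) :
    Real.exp v ≤ 1 + Real.exp (-(l / (1 + l))) / (1 + l) * Real.exp ((1 + l) * v) := by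
  have hl1 : 0 < 1 + l := by linarith
  set θ := 1 / (1 + l) with hθ
  obtain ⟨y, rfl⟩ : ∃ y, v = θ + y := ⟨v - θ, by ring⟩
  have h1 : 1 + (1 + l) * (Real.exp y - 1) ≤ Real.exp ((1 + l) * y) := by
    have := one_add_mul_self_le_rpow_one_add (s := Real.exp y - 1) (p := 1 + l)
      (by linarith [Real.exp_pos y]) (by linarith)
    rw [add_sub_cancel, ← Real.exp_mul] at this
    rwa [mul_comm y] at this
  have h2 : 1 - θ ≤ Real.exp (-θ) := by linarith [Real.add_one_le_exp (-θ)]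
  have e1 : Real.exp (-(l / (1 + l))) / (1 + l) * Real.exp ((1 + l) * (θ + y))
      = Real.exp θ * (θ * Real.exp ((1 + l) * y)) := by
    have : (1 + l) * (θ + y) = l / (1 + l) + θ + (1 + l) * y := by
      rw [hθ]; field_simp; ring
    rw [this, Real.exp_add, Real.exp_add, Real.exp_neg, hθ]
    have := Real.exp_pos (l / (1 + l))
    field_simp
  have e2 : (1 : ℝ) = Real.exp θ * Real.exp (-θ) := by rw [← Real.exp_add]; simp
  have h0 : 0 < θ := by positivity
  have hm : θ * (1 + l) = 1 := by rw [hθ]; field_simp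
  rw [e1, Real.exp_add]
  nth_rewrite 1 [e2]
  rw [← mul_add]
  refine mul_le_mul_of_nonneg_left ?_ (Real.exp_pos _).le
  have h3 := mul_le_mul_of_nonneg_left h1 h0.le
  have h4 : θ * (1 + (1 + l) * (Real.exp y - 1)) = θ + (Real.exp y - 1) := by
    rw [mul_add, ← mul_assoc, hm]; ring
  linarith

lemma param (c s : ℝ) (hs : 0 < s) (hc0 : 0 < c) (hc : 0.4 ≤ c ^ 2) (hε : s * c < 1) :
    ∃ l : ℝ, 0 ≤ l ∧ Real.exp (-(l / (1 + l))) / (1 + l) *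
      Real.exp ((l + l ^ 2) * s ^ 2 / 2 - l * (s * c)) ≤ 1.25 * Real.exp (-(c ^ 2 / 2)) := by
  have red : ∀ l : ℝ, 0 ≤ l → ∀ X : ℝ,
      -(l / (1 + l)) + ((l + l ^ 2) * s ^ 2 / 2 - l * (s * c)) + c ^ 2 / 2 ≤ X →
      Real.exp X ≤ 1.25 * (1 + l) → Real.exp (-(l / (1 + l))) / (1 + l) *
      Real.exp ((l + l ^ 2) * s ^ 2 / 2 - l * (s * c)) ≤ 1.25 * Real.exp (-(c ^ 2 / 2)) := by
    intro l hl X h1 h2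
    have hl1 : 0 < 1 + l := by linarith
    rw [div_mul_eq_mul_div, div_le_iff₀ hl1, ← Real.exp_add]
    have : Real.exp (-(l / (1 + l)) + ((l + l ^ 2) * s ^ 2 / 2 - l * (s * c)))
        ≤ Real.exp (X + -(c ^ 2 / 2)) := Real.exp_le_exp.2 (by linarith)
    rw [Real.exp_add X] at this
    nlinarith [mul_le_mul_of_nonneg_right h2 (Real.exp_pos (-(c ^ 2 / 2))).le]
  have he := Real.exp_one_lt_d9
  have hsc : 0 < s * c := by positivity
  by_cases h : 0.7 * s ≤ c
  · refine ⟨c / s - 1 / 2, ?_, ?_⟩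
    · have : 0.7 ≤ c / s := by rwa [le_div_iff₀ hs]
      linarith
    have hr : 0.7 ≤ c / s := by rwa [le_div_iff₀ hs]
    refine red _ (by linarith) (1 / 3) ?_ ?_
    · obtain ⟨r, hr'⟩ : ∃ r, r = c / s := ⟨_, rfl⟩
      have hcr : c = r * s := by rw [hr']; field_simp
      rw [← hr'] at hr ⊢
      have : 1 / 6 ≤ (r - 1 / 2) / (1 + (r - 1 / 2)) := by
        rw [le_div_iff₀ (by linarith)]; linarith
      subst hcr
      nlinarith [sq_nonneg s]
    · have h3 : Real.exp (1 / 3) ^ 3 ≤ 1.5 ^ 3 := by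
        rw [← Real.exp_nat_mul]; norm_num; norm_num at he; linarith
      have := le_of_pow_le_pow_left₀ (by norm_num) (by norm_num) h3
      linarith
  · push Not at h
    refine ⟨1 / 2, by norm_num, red _ (by norm_num) (1 / 2) ?_ ?_⟩
    · have h5 : s ^ 2 * 0.4 ≤ (s * c) ^ 2 := by nlinarith [sq_nonneg s]
      have h6 : (s * c) ^ 2 ≤ s * c := by nlinarith
      have h7 : c ^ 2 ≤ 0.7 := by nlinarith
      norm_num at *
      nlinarith
    · have h3 : Real.exp (1 / 2) ^ 2 ≤ 1.8 ^ 2 := by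
        rw [← Real.exp_nat_mul]; norm_num; norm_num at he; linarith
      have := le_of_pow_le_pow_left₀ (by norm_num) (by norm_num) h3
      linarith

lemma gauss_mech {k : ℕ} (x y : Fin k → ℝ) (σ s c δ : ℝ) (hσ : 0 < σ) (hs : 0 < s) (hc0 : 0 < c)
    (hc : 0.4 ≤ c ^ 2) (hε : s * c < 1) (hδ : δ = 1.25 * Real.exp (-(c ^ 2 / 2)))
    (hxy : ∑ j, (x j - y j) ^ 2 ≤ s ^ 2 * σ ^ 2) (S : Set (Fin k → ℝ)) (hS : MeasurableSet S) :
    Measure.pi (fun j => gaussianReal (x j) ⟨σ ^ 2, sq_nonneg σ⟩) S ≤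
      ENNReal.ofReal (Real.exp (s * c)) *
        Measure.pi (fun j => gaussianReal (y j) ⟨σ ^ 2, sq_nonneg σ⟩) S + ENNReal.ofReal δ := by
  obtain ⟨l, hl, hK⟩ := param c s hs hc0 hc hε
  rw [← hδ] at hK
  have hδ0 : 0 ≤ δ := by rw [hδ]; positivity
  set v : NNReal := ⟨σ ^ 2, sq_nonneg σ⟩ with hvdef
  have hv : v ≠ 0 := by
    intro h
    have := congrArg NNReal.toReal h
    have h2 : (v : ℝ) = σ ^ 2 := rfl
    rw [h2] at this
    have h3 : 0 < σ ^ 2 := by positivity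
    exact h3.ne' (this.trans NNReal.coe_zero)
  have hvr : (v : ℝ) = σ ^ 2 := rfl
  set r : Fin k → ℝ := fun j => (1 + l) * x j - l * y j with hr
  have form : ∀ m z : Fin k → ℝ, ∏ j, gaussianPDFReal (m j) v (z j) =
      (∏ _j : Fin k, (√(2 * Real.pi * v))⁻¹) *
        Real.exp (∑ j, -(z j - m j) ^ 2 / (2 * σ ^ 2)) := by
    intro m z
    simp only [gaussianPDFReal, hvr]
    rw [Finset.prod_mul_distrib, Real.exp_sum]
  have pt : ∀ z : Fin k → ℝ, ∏ j, gaussianPDFReal (x j) v (z j) ≤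
      Real.exp (s * c) * ∏ j, gaussianPDFReal (y j) v (z j) +
        δ * ∏ j, gaussianPDFReal (r j) v (z j) := by
    intro z
    rw [form, form, form]
    set P := ∏ _j : Fin k, (√(2 * Real.pi * v))⁻¹ with hP
    have hP0 : 0 ≤ P := Finset.prod_nonneg fun _ _ => by positivity
    set A := ∑ j, -(z j - x j) ^ 2 / (2 * σ ^ 2) with hA
    set B := ∑ j, -(z j - y j) ^ 2 / (2 * σ ^ 2) with hB
    set q := (∑ j, (x j - y j) ^ 2) / σ ^ 2 with hq
    have hq' : q ≤ s ^ 2 := by rw [hq, div_le_iff₀ (by positivity)]; exact hxy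
    have hR : ∑ j, -(z j - r j) ^ 2 / (2 * σ ^ 2) = (1 + l) * A - l * B - (l + l ^ 2) * q / 2 := by
      rw [hA, hB, hq, Finset.sum_div, Finset.mul_sum, Finset.mul_sum, Finset.mul_sum,
        Finset.sum_div, ← Finset.sum_sub_distrib, ← Finset.sum_sub_distrib]
      refine Finset.sum_congr rfl fun j _ => ?_
      simp only [hr]
      field_simp
      ring
    rw [hR]
    have hk := key_ineq l hl (A - B - s * c)
    have h1 := mul_le_mul_of_nonneg_left hk (Real.exp_pos (B + s * c)).le
    rw [← Real.exp_add] at h1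
    have e1 : B + s * c + (A - B - s * c) = A := by ring
    rw [e1] at h1
    have e2 : Real.exp (B + s * c) * (Real.exp (-(l / (1 + l))) / (1 + l) *
        Real.exp ((1 + l) * (A - B - s * c))) =
        (Real.exp (-(l / (1 + l))) / (1 + l) *
          Real.exp ((l + l ^ 2) * q / 2 - l * (s * c))) *
        Real.exp ((1 + l) * A - l * B - (l + l ^ 2) * q / 2) := by
      rw [mul_left_comm, mul_assoc, ← Real.exp_add, ← Real.exp_add]
      congr 2
      ring
    have e3 : Real.exp (-(l / (1 + l))) / (1 + l) *
          Real.exp ((l + l ^ 2) * q / 2 - l * (s * c)) ≤ δ := by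
      refine le_trans ?_ hK
      gcongr
    have h2 : Real.exp A ≤ Real.exp (s * c) * Real.exp B +
        δ * Real.exp ((1 + l) * A - l * B - (l + l ^ 2) * q / 2) := by
      refine h1.trans ?_
      rw [mul_add, e2, mul_one, add_comm B, Real.exp_add]
      gcongr
    calc P * Real.exp A ≤ P * _ := mul_le_mul_of_nonneg_left h2 hP0
      _ = _ := by ring
  have hp0 : ∀ m z : Fin k → ℝ, 0 ≤ ∏ j, gaussianPDFReal (m j) v (z j) := fun m z =>
    Finset.prod_nonneg fun i _ => gaussianPDFReal_nonneg _ _ _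
  have hmeas : ∀ m : Fin k → ℝ, Measurable fun z : Fin k → ℝ =>
      ENNReal.ofReal (∏ j, gaussianPDFReal (m j) v (z j)) := by
    intro m
    refine ENNReal.measurable_ofReal.comp (Finset.measurable_prod _ fun j _ => ?_)
    exact (measurable_gaussianPDFReal (m j) v).comp (measurable_pi_apply j)
  have hRle : ENNReal.ofReal δ * Measure.pi (fun j => gaussianReal (r j) v) S
      ≤ ENNReal.ofReal δ := by
    calc _ ≤ ENNReal.ofReal δ * 1 := by gcongr; exact prob_le_one
      _ = _ := mul_one _
  refine le_trans ?_ (add_le_add_right hRle _)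
  rw [pi_gauss_density x v hv, pi_gauss_density y v hv, pi_gauss_density r v hv,
    withDensity_apply _ hS, withDensity_apply _ hS, withDensity_apply _ hS,
    ← lintegral_const_mul _ (hmeas y), ← lintegral_const_mul _ (hmeas r),
    ← lintegral_add_left ((hmeas y).const_mul _)]
  refine lintegral_mono fun z => ?_
  rw [← ENNReal.ofReal_mul (Real.exp_pos _).le, ← ENNReal.ofReal_mul hδ0, ← ENNReal.ofReal_add]
  · exact ENNReal.ofReal_le_ofReal (pt z)
  · exact mul_nonneg (Real.exp_pos _).le (hp0 y z)
  · exact mul_nonneg hδ0 (hp0 r z)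

lemma clip_norm_le {k : ℕ} (u : EuclideanSpace ℝ (Fin k)) (C : ℝ) (hC : 0 < C) :
    ‖clip u C‖ ≤ C := by
  unfold clip
  rw [norm_smul, Real.norm_of_nonneg (le_min zero_le_one (by positivity))]
  by_cases hu : ‖u‖ = 0
  · rw [hu]; simpa using hC.le
  · calc _ ≤ C / ‖u‖ * ‖u‖ := by gcongr; exact min_le_right _ _
      _ = C := by field_simp

/-- Targeted protection. With weights `w_i = τ_out/C` on the high-risk set `H`
and `w_i = 1` otherwise, every record `i ∈ H` satisfies the `(ε_out, δ_t)` per-instance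
bound with `ε_out = (τ_out/(nσ))·√(2 log(1.25/δ_t)) < 1` on every dataset `D`. -/
theorem targeted_protection_high_risk
    {Z : Type*} {k : ℕ} (nullz : Z) (n : ℕ) (hn : 0 < n)
    (C σ δt τout : ℝ) (hC : 0 < C) (hσ : 0 < σ) (hδt0 : 0 < δt) (hδt1 : δt < 1)
    (hτ0 : 0 < τout) (hτC : τout ≤ C)
    (φ : Z → EuclideanSpace ℝ (Fin k)) (hφ : φ nullz = 0)
    (H : Finset (Fin n))
    (w : Fin n → ℝ) (hwdef : ∀ i, w i = if i ∈ H then τout / C else 1)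
    (hε : (τout / ((n : ℝ) * σ)) * Real.sqrt (2 * Real.log (1.25 / δt)) < 1) :
    ∀ D : Fin n → Z, ∀ i ∈ H, ∀ S : Set (Fin k → ℝ), MeasurableSet S →
      Measure.pi (fun j => gaussianReal (fw φ C w D j) ⟨σ ^ 2, sq_nonneg σ⟩) S ≤
        ENNReal.ofReal
            (Real.exp ((τout / ((n : ℝ) * σ)) * Real.sqrt (2 * Real.log (1.25 / δt)))) *
          Measure.pi (fun j =>
            gaussianReal (fw φ C w (Function.update D i nullz) j) ⟨σ ^ 2, sq_nonneg σ⟩) S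
        + ENNReal.ofReal δt := by
  intro D i hi S hS
  have hn' : (0 : ℝ) < n := by exact_mod_cast hn
  have hlog : 0.2 ≤ Real.log (1.25 / δt) := by
    have h1 := Real.one_sub_inv_le_log_of_pos (x := 1.25 / δt) (by positivity)
    rw [inv_div] at h1
    have : δt / 1.25 ≤ 1 / 1.25 := by gcongr
    norm_num at *
    linarith
  have hsq : √(2 * Real.log (1.25 / δt)) ^ 2 = 2 * Real.log (1.25 / δt) :=
    Real.sq_sqrt (by linarith)
  refine gauss_mech _ _ σ (τout / (n * σ)) _ δt hσ (by positivity)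
    (Real.sqrt_pos.2 (by linarith)) (by rw [hsq]; linarith) hε ?_ ?_ S hS
  · rw [hsq, mul_div_cancel_left₀ _ two_ne_zero, Real.exp_neg, Real.exp_log (by positivity)]
    field_simp
  · have hdiff : fw φ C w D - fw φ C w (Function.update D i nullz) =
        (1 / (n : ℝ)) • w i • clip (φ (D i)) C := by
      unfold fw
      rw [← smul_sub, ← Finset.sum_sub_distrib]
      congr 1
      rw [Finset.sum_eq_single i]
      · simp [hφ, clip]
      · intro j _ hj
        simp [Function.update_of_ne hj]
      · simp
    have hnorm : ‖fw φ C w D - fw φ C w (Function.update D i nullz)‖ ≤ τout / n := by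
      rw [hdiff, norm_smul, norm_smul, hwdef i, if_pos hi,
        Real.norm_of_nonneg (by positivity), Real.norm_of_nonneg (by positivity)]
      calc _ ≤ 1 / (n : ℝ) * (τout / C * C) := by gcongr; exact clip_norm_le _ _ hC
        _ = τout / n := by field_simp
    have h2 := pow_le_pow_left₀ (norm_nonneg _) hnorm 2
    rw [EuclideanSpace.real_norm_sq_eq] at h2
    calc _ ≤ (τout / n) ^ 2 := by simpa using h2
      _ = _ := by field_simp
end

section
/- Let Z be a type with a distinguished null record ⊥, let d be a positive natural number (the number of features), and for each feature j : Fin d let B j be a positive natural number of bins with bin-assignment map b_j : Z → Fin (B j). Define the per-record one-hot contribution c : Z → ((j : Fin d) × Fin (B j)) → ℝ by c z (⟨j, β⟩) = 1 if z ≠ ⊥ and β = b_j z, and 0 otherwise (so c ⊥ = 0). Then: (a) for every z ≠ ⊥, the Euclidean norm of c z equals √d; (b) for every dataset D : Fin n → Z and index i, the histogram map h(D) = Σ_{i : Fin n} c (D i) satisfies ‖h(D) − h(D^(−i))‖₂ ≤ √d, where D^(−i) = Function.update D i ⊥; and (c) for ε_s ∈ (0, 1) and δ_s ∈ (0, 1),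 releasing h(D) with independent per-coordinate Gaussian noise of standard deviation σ_s = √d · √(2 · log(1.25 / δ_s)) / ε_s — i.e., the mechanism mapping D to the product Gaussian measure with mean vector h(D) and per-coordinate variance σ_s² — satisfies (ε_s, δ_s)-differential privacy: for all D, D' differing by replacing one coordinate with ⊥ (in either direction) and all measurable S, (M D) S ≤ exp(ε_s) · (M D') S + δ_s. -/
open MeasureTheory ProbabilityTheory

/-- One-hot per-record histogram contribution: `c z` is the indicator vector over the
sigma type `(j : Fin d) × Fin (B j)` of the `d` pairs `(j, b_j z)`, with the null record
contributing the zero vector. -/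
noncomputable def onehot {Z : Type*} [DecidableEq Z] (nullz : Z) {d : ℕ} {B : Fin d → ℕ}
    (bin : (j : Fin d) → Z → Fin (B j)) (z : Z) :
    EuclideanSpace ℝ ((j : Fin d) × Fin (B j)) :=
  WithLp.toLp 2 fun p => if z ≠ nullz ∧ p.2 = bin p.1 z then 1 else 0

/-- Joint histogram of a dataset: `h(D) = Σ_i c (D i)`. -/
noncomputable def hist {Z : Type*} [DecidableEq Z] (nullz : Z) {d n : ℕ} {B : Fin d → ℕ}
    (bin : (j : Fin d) → Z → Fin (B j)) (D : Fin n → Z) :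
    EuclideanSpace ℝ ((j : Fin d) × Fin (B j)) :=
  ∑ i, onehot nullz bin (D i)


lemma gauss_wd (m m' : ℝ) {v : NNReal} (hv : v ≠ 0) :
    gaussianReal m v = (gaussianReal m' v).withDensity
      (fun x => ENNReal.ofReal (Real.exp (((x - m') ^ 2 - (x - m) ^ 2) / (2 * v)))) := by
  rw [gaussianReal_of_var_ne_zero _ hv, gaussianReal_of_var_ne_zero _ hv,
    ← withDensity_mul _ (by fun_prop) (by fun_prop)]
  congr 1
  ext x
  have hv' : (v : ℝ) ≠ 0 := by exact_mod_cast hv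
  simp only [gaussianPDF, Pi.mul_apply, gaussianPDFReal]
  rw [← ENNReal.ofReal_mul (by positivity), mul_assoc (√(2 * Real.pi * (v : ℝ)))⁻¹, ← Real.exp_add]
  congr 3
  field_simp
  ring

lemma pi_gauss_wd {ι : Type*} [Fintype ι] (m m' : ι → ℝ) {v : NNReal} (hv : v ≠ 0) :
    Measure.pi (fun i => gaussianReal (m i) v) =
      (Measure.pi (fun i => gaussianReal (m' i) v)).withDensity
      (fun x => ∏ i, ENNReal.ofReal (Real.exp (((x i - m' i) ^ 2 - (x i - m i) ^ 2) / (2 * v)))) := by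
  refine Measure.pi_eq fun s hs => ?_
  rw [withDensity_apply _ (MeasurableSet.univ_pi hs), ← lintegral_indicator (MeasurableSet.univ_pi hs)]
  set f : ι → ℝ → ENNReal := fun i x =>
    ENNReal.ofReal (Real.exp (((x - m' i) ^ 2 - (x - m i) ^ 2) / (2 * v))) with hf
  have hfm : ∀ i, Measurable (f i) := fun i => by simp only [hf]; fun_prop
  have h1 : (Set.univ.pi s).indicator (fun x : ι → ℝ => ∏ i, f i (x i)) =
      fun x => ∏ i, (s i).indicator (f i) (x i) := by
    ext x
    by_cases hx : x ∈ Set.univ.pi s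
    · rw [Set.indicator_of_mem hx]
      exact Finset.prod_congr rfl fun i _ => (Set.indicator_of_mem (hx i trivial) _).symm
    · rw [Set.indicator_of_notMem hx]
      simp only [Set.mem_pi, Set.mem_univ, true_implies, not_forall] at hx
      obtain ⟨i, hi⟩ := hx
      exact (Finset.prod_eq_zero (Finset.mem_univ i) (Set.indicator_of_notMem hi _)).symm
  rw [h1]
  have hind := iIndepFun_pi (μ := fun i => gaussianReal (m' i) v)
    (X := fun i => (s i).indicator (f i))
    (fun i => ((hfm i).indicator (hs i)).aemeasurable)
  have := lintegral_prod_eq_prod_lintegral_of_indepFun Finset.univ _ hind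
    (fun i => ((hfm i).indicator (hs i)).comp (measurable_pi_apply i))
  rw [this]
  refine Finset.prod_congr rfl fun i _ => ?_
  rw [gauss_wd (m i) (m' i) hv, withDensity_apply _ (hs i), ← lintegral_indicator (hs i)]
  exact ((measurePreserving_eval (fun i => gaussianReal (m' i) v) i).lintegral_comp
    ((hfm i).indicator (hs i)))

lemma pi_gauss_lin {ι : Type*} [Fintype ι] (m a : ι → ℝ) (v : NNReal) 
    (ha : v * ∑ i, a i ^ 2 = 1) :
    (Measure.pi (fun i => gaussianReal (m i) v)).map (fun x => ∑ i, a i * (x i - m i)) =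
      gaussianReal 0 1 := by
  have hmeas : Measurable (fun x : ι → ℝ => ∑ i, a i * (x i - m i)) := by fun_prop
  have := Measure.isProbabilityMeasure_map (μ := Measure.pi (fun i => gaussianReal (m i) v)) hmeas.aemeasurable
  apply Measure.ext_of_charFun
  ext t
  rw [charFun_apply_real, integral_map hmeas.aemeasurable (by fun_prop), charFun_gaussianReal]
  have : ∀ x : ι → ℝ, Complex.exp (t * ((∑ i, a i * (x i - m i) : ℝ) : ℂ) * Complex.I) =
      ∏ i, (Complex.exp (-(t * a i * m i) * Complex.I) *
        Complex.exp ((t * a i : ℝ) * (x i : ℂ) * Complex.I)) := by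
    intro x
    simp_rw [← Complex.exp_add]
    rw [← Complex.exp_sum]
    congr 1
    push_cast
    rw [Finset.mul_sum, Finset.sum_mul]
    exact Finset.sum_congr rfl fun i _ => by ring
  simp_rw [this]
  rw [integral_fintype_prod_eq_prod (f := fun i (x : ℝ) => Complex.exp (-(t * a i * m i) * Complex.I) *
        Complex.exp ((t * a i : ℝ) * (x : ℂ) * Complex.I))]
  simp_rw [integral_const_mul, ← charFun_apply_real, charFun_gaussianReal, ← Complex.exp_add]
  rw [← Complex.exp_sum]
  congr 1
  have ha' : (v : ℂ) * ∑ i, (a i : ℂ) ^ 2 = 1 := by exact_mod_cast ha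
  have : ∀ i, -(t * a i * m i : ℂ) * Complex.I + ((t * a i : ℝ) * m i * Complex.I - v * ((t * a i : ℝ) : ℂ) ^ 2 / 2)
      = - (t : ℂ) ^ 2 / 2 * (v * (a i : ℂ) ^ 2) := by
    intro i; push_cast; ring
  simp_rw [this]
  rw [← Finset.mul_sum, ← Finset.mul_sum, ha']
  simp
  ring

lemma half_tail : gaussianReal 0 1 (Set.Ioi 0) ≤ ENNReal.ofReal (1 / 2) := by
  have h1 : gaussianReal 0 1 (Set.Iio 0) = gaussianReal 0 1 (Set.Ioi 0) := by
    have := gaussianReal_map_neg (μ := 0) (v := 1)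
    rw [neg_zero] at this
    conv_lhs => rw [← this]
    rw [Measure.map_apply (by fun_prop) measurableSet_Iio]
    congr 1
    ext x; simp
  have h2 : gaussianReal 0 1 (Set.Iio 0) + gaussianReal 0 1 (Set.Ioi 0) ≤ 1 := by
    rw [← measure_union (by
      rw [Set.disjoint_left]; intro x hx hx'; exact lt_asymm (Set.mem_Iio.1 hx) (Set.mem_Ioi.1 hx')) measurableSet_Ioi]
    exact prob_le_one
  rw [h1, ← two_mul] at h2
  rw [ENNReal.ofReal_div_of_pos (by norm_num), ENNReal.le_div_iff_mul_le (by simp) (by simp), mul_comm]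
  simpa using h2

lemma tail_pos {t : ℝ} (ht : 0 ≤ t) :
    gaussianReal 0 1 (Set.Ioi t) ≤ ENNReal.ofReal (1 / 2 * Real.exp (-t ^ 2 / 2)) := by
  have h1 : gaussianReal 0 1 (Set.Ioi t) = gaussianReal (-t) 1 (Set.Ioi 0) := by
    have := gaussianReal_map_sub_const (μ := 0) (v := 1) t
    rw [zero_sub] at this
    rw [← this, Measure.map_apply (by fun_prop) measurableSet_Ioi]
    congr 1
    ext x; simp
  rw [h1, gauss_wd (-t) 0 one_ne_zero, withDensity_apply _ measurableSet_Ioi]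
  calc _ ≤ ∫⁻ x in Set.Ioi 0, ENNReal.ofReal (Real.exp (-t ^ 2 / 2)) ∂gaussianReal 0 1 := by
        refine setLIntegral_mono (by fun_prop) fun x hx => ?_
        have hx : 0 < x := hx
        refine ENNReal.ofReal_le_ofReal (Real.exp_le_exp.2 ?_)
        simp only [NNReal.coe_one]
        nlinarith [mul_nonneg ht hx.le]
    _ = ENNReal.ofReal (Real.exp (-t ^ 2 / 2)) * gaussianReal 0 1 (Set.Ioi 0) := by simp
    _ ≤ ENNReal.ofReal (Real.exp (-t ^ 2 / 2)) * ENNReal.ofReal (1/2) := by gcongr; exact half_tail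
    _ = _ := by rw [← ENNReal.ofReal_mul (by positivity), mul_comm]

lemma tail_neg {t : ℝ} (ht : t ≤ 0) :
    gaussianReal 0 1 (Set.Ioi t) ≤ ENNReal.ofReal (1 / 2 - t) := by
  have h : gaussianReal 0 1 (Set.Ioc t 0) ≤ ENNReal.ofReal (-t) := by
    rw [gaussianReal_apply _ one_ne_zero]
    calc _ ≤ ∫⁻ x in Set.Ioc t 0, 1 := by
          refine setLIntegral_mono (by fun_prop) fun x _ => ?_
          rw [gaussianPDF, ENNReal.ofReal_le_one, gaussianPDFReal]
          have h1 : (√(2 * Real.pi * (1 : NNReal)))⁻¹ ≤ 1 := by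
            apply inv_le_one_of_one_le₀
            rw [Real.one_le_sqrt]
            simp; linarith [Real.pi_gt_three]
          have h2 : Real.exp (-(x - 0) ^ 2 / (2 * (1 : NNReal))) ≤ 1 := by
            rw [Real.exp_le_one_iff]
            simp; nlinarith [sq_nonneg x]
          exact mul_le_one₀ h1 (Real.exp_nonneg _) h2
      _ = _ := by simp
  rw [← Set.Ioc_union_Ioi_eq_Ioi ht]
  refine (measure_union_le _ _).trans ((add_le_add h half_tail).trans ?_)
  rw [← ENNReal.ofReal_add (by linarith) (by norm_num)]
  exact ENNReal.ofReal_le_ofReal (by linarith)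

lemma tail_bound {ε δ c : ℝ} (h0 : 0 < ε) (h1 : ε < 1) (hδ : 0 < δ) (hδ1 : δ < 1)
    (hc : 0 < c) (hc2 : c ^ 2 = 2 * Real.log (1.25 / δ)) :
    gaussianReal 0 1 (Set.Ioi (c - ε / (2 * c))) ≤ ENNReal.ofReal δ := by
  set t := c - ε / (2 * c) with ht
  have hδe : δ = 1.25 * Real.exp (- c ^ 2 / 2) := by
    rw [neg_div, hc2, mul_div_cancel_left₀ _ two_ne_zero, Real.exp_neg, Real.exp_log (by positivity)]
    field_simp
  have htc : t * c = c ^ 2 - ε / 2 := by rw [ht]; field_simp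
  rcases le_total 0 t with h | h
  · refine (tail_pos h).trans (ENNReal.ofReal_le_ofReal ?_)
    have ht2 : c ^ 2 - 1 ≤ t ^ 2 := by
      have : t ^ 2 = c ^ 2 - ε + (ε / (2 * c)) ^ 2 := by rw [ht]; field_simp; ring
      nlinarith [sq_nonneg (ε / (2 * c))]
    have : Real.exp (-t ^ 2 / 2) ≤ Real.exp (1 / 2) * Real.exp (- c ^ 2 / 2) := by
      rw [← Real.exp_add, Real.exp_le_exp]; linarith
    have he : Real.exp (1 / 2) ≤ 2.5 := by
      have h := Real.exp_one_lt_d9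
      have h2 : Real.exp (1 / 2) ^ 2 = Real.exp 1 := by
        rw [← Real.exp_nat_mul]; norm_num
      nlinarith [Real.exp_pos (1 / 2)]
    rw [hδe]
    nlinarith [Real.exp_pos (- c ^ 2 / 2)]
  · refine (tail_neg h).trans (ENNReal.ofReal_le_ofReal ?_)
    have hc1 : c ^ 2 ≤ 1 / 2 := by nlinarith
    have hlog : 0.4 ≤ c ^ 2 := by
      have h3 := Real.one_sub_inv_le_log_of_pos (x := 1.25 / δ) (by positivity)
      rw [inv_div] at h3
      rw [hc2]; norm_num at h3 ⊢; linarith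
    have hδl : 0.9 ≤ δ := by
      have := Real.add_one_le_exp (- c ^ 2 / 2)
      rw [hδe]; linarith
    have hc6 : 0.6 ≤ c := by nlinarith
    have : -t ≤ 1/4 := by
      by_contra hh
      push Not at hh
      nlinarith
    linarith

lemma mech {ι : Type*} [Fintype ι] (m m' : ι → ℝ) {ε δ c s d : ℝ} (h0 : 0 < ε) (h1 : ε < 1)
    (hδ : 0 < δ) (hδ1 : δ < 1) (hc : 0 < c) (hc2 : c ^ 2 = 2 * Real.log (1.25 / δ))
    (hd : 0 < d) (v : NNReal) (hs : s = d * c / ε) (hv : (v : ℝ) = s ^ 2)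
    (hm : ∑ i, (m i - m' i) ^ 2 = d ^ 2) (S : Set (ι → ℝ)) (hS : MeasurableSet S) :
    Measure.pi (fun i => gaussianReal (m i) v) S ≤
      ENNReal.ofReal (Real.exp ε) * Measure.pi (fun i => gaussianReal (m' i) v) S
        + ENNReal.ofReal δ := by
  have hs0 : 0 < s := by rw [hs]; positivity
  have hv0 : v ≠ 0 := by
    intro h; rw [h] at hv; rw [NNReal.coe_zero] at hv; exact (pow_pos hs0 2).ne hv
  set t := c - ε / (2 * c) with ht
  set a : ι → ℝ := fun i => (m i - m' i) / (s * d) with ha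
  set L : (ι → ℝ) → ℝ := fun x => ∑ i, a i * (x i - m i) with hL
  have hLm : Measurable L := by simp only [hL]; fun_prop
  have hlaw : (Measure.pi (fun i => gaussianReal (m i) v)).map L = gaussianReal 0 1 := by
    apply pi_gauss_lin
    simp only [ha, div_pow]
    rw [← Finset.sum_div, hm, hv]
    field_simp
  have hbad : Measure.pi (fun i => gaussianReal (m i) v) (L ⁻¹' Set.Ioi t) ≤ ENNReal.ofReal δ := by
    rw [← Measure.map_apply hLm measurableSet_Ioi, hlaw]
    exact tail_bound h0 h1 hδ hδ1 hc hc2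
  have hG : MeasurableSet (L ⁻¹' Set.Ioi t) := hLm measurableSet_Ioi
  have hgood : Measure.pi (fun i => gaussianReal (m i) v) (S \ L ⁻¹' Set.Ioi t) ≤
      ENNReal.ofReal (Real.exp ε) * Measure.pi (fun i => gaussianReal (m' i) v) S := by
    rw [pi_gauss_wd m m' hv0, withDensity_apply _ (hS.diff hG)]
    calc _ ≤ ∫⁻ x in S \ L ⁻¹' Set.Ioi t, ENNReal.ofReal (Real.exp ε)
          ∂(Measure.pi (fun i => gaussianReal (m' i) v)) := by
          refine setLIntegral_mono (by fun_prop) fun x hx => ?_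
          have hx : L x ≤ t := by simpa using hx.2
          rw [← ENNReal.ofReal_prod_of_nonneg (fun _ _ => (Real.exp_nonneg _)), ← Real.exp_sum]
          apply ENNReal.ofReal_le_ofReal
          rw [Real.exp_le_exp]
          have key : ∑ i, ((x i - m' i) ^ 2 - (x i - m i) ^ 2) / (2 * (v : ℝ)) =
              L x * (d / s) + d ^ 2 / (2 * s ^ 2) := by
            rw [← hm, hL, Finset.sum_mul, Finset.sum_div, ← Finset.sum_add_distrib]
            refine Finset.sum_congr rfl fun i _ => ?_
            rw [hv, ha]
            field_simp
            ring
          rw [key]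
          have : t * (d / s) + d ^ 2 / (2 * s ^ 2) = ε := by
            rw [ht, hs]; field_simp; ring
          rw [← this]
          gcongr
      _ = ENNReal.ofReal (Real.exp ε) * Measure.pi (fun i => gaussianReal (m' i) v)
            (S \ L ⁻¹' Set.Ioi t) := by simp
      _ ≤ _ := by gcongr; exact Set.sdiff_subset
  calc _ ≤ Measure.pi (fun i => gaussianReal (m i) v) ((S \ L ⁻¹' Set.Ioi t) ∪ L ⁻¹' Set.Ioi t) :=
        measure_mono (by rw [Set.sdiff_union_self]; exact Set.subset_union_left)
    _ ≤ _ := (measure_union_le _ _).trans (add_le_add hgood hbad)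

lemma onehot_norm {Z : Type*} [DecidableEq Z] (nullz : Z) {d : ℕ} {B : Fin d → ℕ}
    (bin : (j : Fin d) → Z → Fin (B j)) (z : Z) (hz : z ≠ nullz) :
    ‖onehot nullz bin z‖ = Real.sqrt d := by
  rw [EuclideanSpace.norm_eq]
  congr 1
  rw [Fintype.sum_sigma]
  simp [onehot, hz]

lemma onehot_null {Z : Type*} [DecidableEq Z] (nullz : Z) {d : ℕ} {B : Fin d → ℕ}
    (bin : (j : Fin d) → Z → Fin (B j)) : onehot nullz bin nullz = 0 := by
  ext p
  simp [onehot]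

lemma hist_sub {Z : Type*} [DecidableEq Z] (nullz : Z) {d n : ℕ} {B : Fin d → ℕ}
    (bin : (j : Fin d) → Z → Fin (B j)) (D : Fin n → Z) (i : Fin n) :
    hist nullz bin D - hist nullz bin (Function.update D i nullz) = onehot nullz bin (D i) := by
  rw [hist, hist, ← Finset.sum_sub_distrib, Finset.sum_eq_single i]
  · simp [onehot_null]
  · intro j _ hj
    simp [Function.update_of_ne hj]
  · simp

/-- DP histogram scoring. (a) Each non-null record's one-hot contribution
has Euclidean norm `√d`; (b) the joint histogram has record-level influence at most `√d`;
(c) releasing the histogram with per-coordinate Gaussian noise of standard deviation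
`σ_s = √d · √(2 log(1.25/δ_s)) / ε_s` is `(ε_s, δ_s)`-differentially private for the
replace-one-coordinate-by-⊥ neighbor relation. -/
theorem dp_histogram_scoring
    {Z : Type*} [DecidableEq Z] (nullz : Z) (d : ℕ) (hd : 0 < d) (n : ℕ) (hn : 0 < n)
    (B : Fin d → ℕ) (hB : ∀ j, 0 < B j)
    (bin : (j : Fin d) → Z → Fin (B j))
    (εs δs : ℝ) (hεs0 : 0 < εs) (hεs1 : εs < 1) (hδs0 : 0 < δs) (hδs1 : δs < 1) :
    (∀ z : Z, z ≠ nullz → ‖onehot nullz bin z‖ = Real.sqrt d) ∧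
      (∀ (D : Fin n → Z) (i : Fin n),
        ‖hist nullz bin D - hist nullz bin (Function.update D i nullz)‖ ≤ Real.sqrt d) ∧
      (∀ D D' : Fin n → Z,
        (∃ i, D' = Function.update D i nullz ∨ D = Function.update D' i nullz) →
        ∀ S : Set (((j : Fin d) × Fin (B j)) → ℝ), MeasurableSet S →
          Measure.pi (fun p => gaussianReal (hist nullz bin D p)
              ⟨(Real.sqrt d * Real.sqrt (2 * Real.log (1.25 / δs)) / εs) ^ 2,
                sq_nonneg _⟩) S ≤
            ENNReal.ofReal (Real.exp εs) *
              Measure.pi (fun p => gaussianReal (hist nullz bin D' p)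
                ⟨(Real.sqrt d * Real.sqrt (2 * Real.log (1.25 / δs)) / εs) ^ 2,
                  sq_nonneg _⟩) S
            + ENNReal.ofReal δs) := by
  have hb : ∀ (D : Fin n → Z) (i : Fin n),
      ‖hist nullz bin D - hist nullz bin (Function.update D i nullz)‖ = 0 ∨
      ‖hist nullz bin D - hist nullz bin (Function.update D i nullz)‖ = Real.sqrt d := by
    intro D i
    rw [hist_sub]
    by_cases h : D i = nullz
    · left; rw [h, onehot_null, norm_zero]
    · right; exact onehot_norm nullz bin _ h
  refine ⟨fun z hz => onehot_norm nullz bin z hz, fun D i => ?_, ?_⟩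
  · rcases hb D i with h | h
    · rw [h]; exact Real.sqrt_nonneg _
    · exact h.le
  · rintro D D' ⟨i, hi⟩ S hS
    have hn : ‖hist nullz bin D - hist nullz bin D'‖ = 0 ∨
        ‖hist nullz bin D - hist nullz bin D'‖ = Real.sqrt d := by
      rcases hi with rfl | rfl
      · exact hb D i
      · rw [norm_sub_rev]; exact hb D' i
    rcases hn with h | h
    · rw [norm_sub_eq_zero_iff] at h
      rw [h]
      refine le_add_right (le_mul_of_one_le_left zero_le ?_)
      rw [ENNReal.one_le_ofReal]
      exact Real.one_le_exp hεs0.le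
    · have hlog : 0 < Real.log (1.25 / δs) := by
        apply Real.log_pos
        rw [lt_div_iff₀ hδs0]
        linarith
      refine mech (ι := (j : Fin d) × Fin (B j)) (fun p => hist nullz bin D p)
        (fun p => hist nullz bin D' p) (c := Real.sqrt (2 * Real.log (1.25 / δs)))
        (d := Real.sqrt d) hεs0 hεs1 hδs0 hδs1 (Real.sqrt_pos.2 (by positivity))
        (Real.sq_sqrt (by positivity)) (Real.sqrt_pos.2 (by exact_mod_cast hd)) _ rfl rfl ?_ S hS
      rw [← h, EuclideanSpace.real_norm_sq_eq]
      rfl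
end
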